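/- arXiv:2011.03876 — 8 statements merged into one kernel-verified Lean document; each statement's English description precedes it below -/
import Mathlib

section
/- Let M and A be real 2×2 matrices and let σ > 0 satisfy ‖Mv‖ ≥ σ‖v‖ for every v ∈ ℝ² (i.e., σ is a lower bound for the singular values of M). Then (sgn(det A)·cof(A) − sgn(det M)·cof(M)) : (A − M) ≥ −(|det M| / σ²)·|A − M|². -/
noncomputable section

open Matrix

/-- Frobenius inner product `A : B = ∑_{i,j} A_{ij} B_{ij}`. -/
def frobInner {d : ℕ} (A B : Matrix (Fin d) (Fin d) ℝ) : ℝ := ∑ i, ∑ j, A i j * B i j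

/-- Frobenius norm `|A| = √(A : A)`. -/
def frobNorm {d : ℕ} (A : Matrix (Fin d) (Fin d) ℝ) : ℝ := Real.sqrt (∑ i, ∑ j, (A i j) ^ 2)

/-- Cofactor matrix: the transpose of the adjugate, so that `Mᵀ * cof M = det M • 1`. -/
def cof {d : ℕ} (M : Matrix (Fin d) (Fin d) ℝ) : Matrix (Fin d) (Fin d) ℝ := (Matrix.adjugate M)ᵀ

/-- In dimension two, `σ ^ 2` bounds `|det M|` from below when `σ` bounds the singular values. -/
theorem sq_le_abs_det_of_forall_mulVec {M : Matrix (Fin 2) (Fin 2) ℝ} {σ : ℝ} (hσ : 0 < σ)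
    (h : ∀ x y : ℝ, σ ^ 2 * (x ^ 2 + y ^ 2) ≤
      (M 0 0 * x + M 0 1 * y) ^ 2 + (M 1 0 * x + M 1 1 * y) ^ 2) :
    σ ^ 2 ≤ |M.det| := by
  have h₁ := h 1 0
  have h₂ := h 0 1
  have h₃ := h (M 1 1) (-M 1 0)
  have h₄ := h (-M 0 1) (M 0 0)
  have hσ' : 0 < σ ^ 2 := by positivity
  refine le_trans (le_abs_self _) (sq_le_sq.mp ?_)
  rw [det_fin_two]
  have h₅ := mul_le_mul_of_nonneg_left (add_le_add h₁ h₂) hσ'.le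
  linarith

/-- For `2 × 2` matrices, the sign-weighted cofactor map is monotone up to `-|A - M| ^ 2`. -/
theorem neg_sq_le_frobInner_sign_cof (M A : Matrix (Fin 2) (Fin 2) ℝ) (hM : M.det ≠ 0) :
    -(frobNorm (A - M)) ^ 2 ≤
      frobInner (Real.sign A.det • cof A - Real.sign M.det • cof M) (A - M) := by
  have hN : frobNorm (A - M) ^ 2 = ∑ i, ∑ j, ((A - M) i j) ^ 2 :=
    Real.sq_sqrt (by positivity)
  rw [hN]
  simp only [frobInner, cof, adjugate_fin_two, Fin.sum_univ_two, Matrix.sub_apply,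
    Matrix.smul_apply, transpose_apply, of_apply, cons_val_zero, cons_val_one, smul_eq_mul]
  rw [det_fin_two] at hM
  simp only [det_fin_two]
  generalize M 0 0 = a at *
  generalize M 0 1 = b at *
  generalize M 1 0 = c at *
  generalize M 1 1 = d at *
  generalize A 0 0 = p at *
  generalize A 0 1 = q at *
  generalize A 1 0 = r at *
  generalize A 1 1 = s at *
  have e₁ := sq_nonneg (p - a - (s - d))
  have e₂ := sq_nonneg (p - a + (s - d))
  have e₃ := sq_nonneg (q - b - (r - c))
  have e₄ := sq_nonneg (q - b + (r - c))
  rcases hM.lt_or_gt with hm | hm <;>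
  rcases lt_trichotomy (p * s - q * r) 0 with ha | ha | ha <;>
  simp only [Real.sign_of_neg, Real.sign_of_pos, Real.sign_zero, hm, ha] <;>
  rcases le_total 0 (s * a - r * b - q * c + p * d) with hc | hc <;>
  linarith

/-- the two-dimensional matrix inequality. If every singular value of `M` is
at least `σ > 0` (i.e. `‖M v‖ ≥ σ ‖v‖` for every `v ∈ ℝ²` in the Euclidean norm), then
`(sgn(det A)·cof A − sgn(det M)·cof M) : (A − M) ≥ −(|det M| / σ²)·|A − M|²`. -/
theorem stmt_0 (M A : Matrix (Fin 2) (Fin 2) ℝ) (σ : ℝ) (hσ : 0 < σ)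
    (hM : ∀ v : EuclideanSpace ℝ (Fin 2), σ * ‖v‖ ≤
      ‖(EuclideanSpace.equiv (Fin 2) ℝ).symm (M.mulVec (EuclideanSpace.equiv (Fin 2) ℝ v))‖) :
    frobInner (Real.sign A.det • cof A - Real.sign M.det • cof M) (A - M)
      ≥ -(|M.det| / σ ^ 2) * (frobNorm (A - M)) ^ 2 := by
  have hdet : σ ^ 2 ≤ |M.det| := by
    refine sq_le_abs_det_of_forall_mulVec hσ fun x y => ?_
    have h := pow_le_pow_left₀ (by positivity) (hM !₂[x, y]) 2
    rw [mul_pow, EuclideanSpace.real_norm_sq_eq, EuclideanSpace.real_norm_sq_eq] at h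
    simpa [Fin.sum_univ_two, mulVec, dotProduct] using h
  have hσ' : 0 < σ ^ 2 := by positivity
  have hK : 1 ≤ |M.det| / σ ^ 2 := (one_le_div hσ').mpr hdet
  have hne : M.det ≠ 0 := abs_pos.mp (hσ'.trans_le hdet)
  have h₁ := neg_sq_le_frobInner_sign_cof M A hne
  have h₂ := le_mul_of_one_le_left (sq_nonneg (frobNorm (A - M))) hK
  linarith
end
end

section
/- Let M and A be real 3×3 matrices and let σ > 0 satisfy ‖Mv‖ ≥ σ‖v‖ for every v ∈ ℝ³ (i.e., σ is a lower bound for the singular values of M). Then (sgn(det A)·cof(A) − sgn(det M)·cof(M)) : (A − M) ≥ −(1 + (3/2)(1 + √3))·(|det M| / σ²)·|A − M|². -/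
noncomputable section

open Matrix

/-- Hadamard-type bound: `(det K)² ≤ |K|⁶ / 4`. -/
lemma four_mul_det_sq_le (a b c d e f g h i : ℝ) :
    4 * (a * e * i - a * f * h - b * d * i + b * f * g + c * d * h - c * e * g) ^ 2 ≤
      (a ^ 2 + b ^ 2 + c ^ 2 + d ^ 2 + e ^ 2 + f ^ 2 + g ^ 2 + h ^ 2 + i ^ 2) ^ 3 := by
  have cauchy : ∀ x y z : ℝ, (a * x + b * y + c * z) ^ 2 ≤
      (a ^ 2 + b ^ 2 + c ^ 2) * (x ^ 2 + y ^ 2 + z ^ 2) := fun x y z => by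
    nlinarith [sq_nonneg (a * y - b * x), sq_nonneg (a * z - c * x), sq_nonneg (b * z - c * y)]
  have lagrange : (e * i - f * h) ^ 2 + (f * g - d * i) ^ 2 + (d * h - e * g) ^ 2 ≤
      (d ^ 2 + e ^ 2 + f ^ 2) * (g ^ 2 + h ^ 2 + i ^ 2) := by
    nlinarith [sq_nonneg (d * g + e * h + f * i)]
  have hP : 0 ≤ a ^ 2 + b ^ 2 + c ^ 2 := by positivity
  have hQ : 0 ≤ d ^ 2 + e ^ 2 + f ^ 2 := by positivity
  have hR : 0 ≤ g ^ 2 + h ^ 2 + i ^ 2 := by positivity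
  have key : (a * e * i - a * f * h - b * d * i + b * f * g + c * d * h - c * e * g) ^ 2 ≤
      (a ^ 2 + b ^ 2 + c ^ 2) * ((d ^ 2 + e ^ 2 + f ^ 2) * (g ^ 2 + h ^ 2 + i ^ 2)) := by
    refine le_trans (le_of_eq ?_) ((cauchy (e * i - f * h) (f * g - d * i) (d * h - e * g)).trans
      (mul_le_mul_of_nonneg_left lagrange hP))
    ring
  have amgm : ∀ P Q R : ℝ, 0 ≤ P → 0 ≤ Q → 0 ≤ R → 4 * (P * (Q * R)) ≤ (P + Q + R) ^ 3 :=
    fun P Q R h₁ h₂ h₃ => by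
      have h₄ : P * (4 * (Q * R)) ≤ (P + Q + R) * (P + Q + R) ^ 2 :=
        mul_le_mul (by linarith)
          (by nlinarith [sq_nonneg (Q - R), mul_nonneg h₁ h₂, mul_nonneg h₁ h₃])
          (by positivity) (by positivity)
      linarith
  have := amgm _ _ _ hP hQ hR
  calc _ ≤ _ := mul_le_mul_of_nonneg_left key (by norm_num)
    _ ≤ _ := this
    _ = _ := by ring

/-- The case `M = 1` in terms of the elementary symmetric functions `e₁, e₂, e₃` of `K = A - 1`,
where `n` is the Frobenius norm of `K`. -/
lemma sign_mul_sub_ge (n e₁ e₂ e₃ : ℝ) (hn : 0 ≤ n) (h₁ : e₁ ^ 2 ≤ 3 * n ^ 2)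
    (h₂ : -n ^ 2 ≤ 2 * e₂) (h₂' : e₂ ≤ n ^ 2) (h₃ : 4 * e₃ ^ 2 ≤ (n ^ 2) ^ 3) :
    -5 * n ^ 2 ≤ Real.sign (1 + e₁ + e₂ + e₃) * (e₁ + 2 * e₂ + 3 * e₃) - e₁ := by
  have g₁ : |e₁| ≤ 7 / 4 * n := abs_le_of_sq_le_sq (by nlinarith) (by positivity)
  have g₃ : |e₃| ≤ n ^ 3 / 2 := abs_le_of_sq_le_sq (by nlinarith) (by positivity)
  rw [abs_le] at g₁ g₃
  rcases lt_trichotomy (1 + e₁ + e₂ + e₃) 0 with h | h | h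
  · rw [Real.sign_of_neg h]
    nlinarith [sq_nonneg (n - 1 / 3)]
  · rw [h, Real.sign_zero]
    rcases le_total n (1 / 2) with hs | hs
    · have : n ^ 3 ≤ (1 / 2) ^ 3 := by gcongr
      nlinarith
    · nlinarith
  · rw [Real.sign_of_pos h]
    rcases le_total n 2 with hs | hs
    · have : n ^ 3 ≤ 2 * n ^ 2 := by nlinarith [sq_nonneg n]
      nlinarith
    · nlinarith

lemma frobNorm_sq {d : ℕ} (A : Matrix (Fin d) (Fin d) ℝ) :
    frobNorm A ^ 2 = ∑ i, ∑ j, A i j ^ 2 :=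
  Real.sq_sqrt (by positivity)

lemma frobInner_eq_trace {d : ℕ} (A B : Matrix (Fin d) (Fin d) ℝ) :
    frobInner A B = (Aᵀ * B).trace := by
  simp only [frobInner, Matrix.trace, Matrix.diag, Matrix.mul_apply, Matrix.transpose_apply]
  exact Finset.sum_comm

lemma sign_det_mul_trace_adjugate_ge (K : Matrix (Fin 3) (Fin 3) ℝ) :
    -5 * frobNorm K ^ 2 ≤
      Real.sign (1 + K).det * ((1 + K).adjugate * K).trace - K.trace := by
  have h := sign_mul_sub_ge (frobNorm K) (K 0 0 + K 1 1 + K 2 2)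
    (K 0 0 * K 1 1 - K 0 1 * K 1 0 + (K 0 0 * K 2 2 - K 0 2 * K 2 0)
      + (K 1 1 * K 2 2 - K 1 2 * K 2 1)) K.det (Real.sqrt_nonneg _)
  have hd : (1 + K).det = 1 + (K 0 0 + K 1 1 + K 2 2) +
      (K 0 0 * K 1 1 - K 0 1 * K 1 0 + (K 0 0 * K 2 2 - K 0 2 * K 2 0)
      + (K 1 1 * K 2 2 - K 1 2 * K 2 1)) + K.det := by
    simp [Matrix.det_fin_three, Matrix.add_apply]
    ring
  have ht : ((1 + K).adjugate * K).trace = (K 0 0 + K 1 1 + K 2 2) +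
      2 * (K 0 0 * K 1 1 - K 0 1 * K 1 0 + (K 0 0 * K 2 2 - K 0 2 * K 2 0)
      + (K 1 1 * K 2 2 - K 1 2 * K 2 1)) + 3 * K.det := by
    rw [Matrix.trace_fin_three]
    simp only [Matrix.mul_apply, Fin.sum_univ_three, Matrix.adjugate_fin_three]
    simp [Matrix.det_fin_three, Matrix.add_apply]
    ring
  rw [hd, ht, Matrix.trace_fin_three]
  apply h <;> rw [frobNorm_sq] <;> simp only [Fin.sum_univ_three]
  · nlinarith [sq_nonneg (K 0 0 - K 1 1), sq_nonneg (K 0 0 - K 2 2), sq_nonneg (K 1 1 - K 2 2),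
      sq_nonneg (K 0 1), sq_nonneg (K 0 2), sq_nonneg (K 1 0), sq_nonneg (K 1 2),
      sq_nonneg (K 2 0), sq_nonneg (K 2 1)]
  · nlinarith [sq_nonneg (K 0 0 + K 1 1 + K 2 2), sq_nonneg (K 0 1 - K 1 0),
      sq_nonneg (K 0 2 - K 2 0), sq_nonneg (K 1 2 - K 2 1)]
  · nlinarith [sq_nonneg (K 0 0 - K 1 1), sq_nonneg (K 0 0 - K 2 2), sq_nonneg (K 1 1 - K 2 2),
      sq_nonneg (K 0 1 + K 1 0), sq_nonneg (K 0 2 + K 2 0), sq_nonneg (K 1 2 + K 2 1),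
      sq_nonneg (K 0 1), sq_nonneg (K 0 2), sq_nonneg (K 1 0), sq_nonneg (K 1 2),
      sq_nonneg (K 2 0), sq_nonneg (K 2 1)]
  · rw [Matrix.det_fin_three]
    have := four_mul_det_sq_le (K 0 0) (K 0 1) (K 0 2) (K 1 0) (K 1 1) (K 1 2)
      (K 2 0) (K 2 1) (K 2 2)
    convert this using 2
    ring

lemma real_sign_mul (x y : ℝ) : Real.sign (x * y) = Real.sign x * Real.sign y := by
  rcases lt_trichotomy x 0 with hx | rfl | hx <;> rcases lt_trichotomy y 0 with hy | rfl | hy <;>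
    simp [Real.sign_of_neg, Real.sign_of_pos, mul_pos_of_neg_of_neg, mul_neg_of_neg_of_pos,
      mul_neg_of_pos_of_neg, *]

lemma frobInner_sign_cof_sub (M K : Matrix (Fin 3) (Fin 3) ℝ) :
    frobInner (Real.sign (M * (1 + K)).det • cof (M * (1 + K)) - Real.sign M.det • cof M) (M * K) =
      |M.det| * (Real.sign (1 + K).det * ((1 + K).adjugate * K).trace - K.trace) := by
  have hs : Real.sign M.det * M.det = |M.det| := by
    rcases lt_trichotomy M.det 0 with h | h | h
    · rw [Real.sign_of_neg h, abs_of_neg h]; ring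
    · simp [h]
    · rw [Real.sign_of_pos h, abs_of_pos h]; ring
  have hA : (1 + K).adjugate * M.adjugate * (M * K) = M.det • ((1 + K).adjugate * K) := by
    rw [Matrix.mul_assoc, ← Matrix.mul_assoc M.adjugate, Matrix.adjugate_mul]
    simp
  have hB : M.adjugate * (M * K) = M.det • K := by
    rw [← Matrix.mul_assoc, Matrix.adjugate_mul]
    simp
  rw [frobInner_eq_trace, Matrix.det_mul, real_sign_mul, ← hs]
  simp only [cof, Matrix.transpose_sub, Matrix.transpose_smul, Matrix.transpose_transpose,
    Matrix.adjugate_mul_distrib, Matrix.sub_mul, Matrix.smul_mul, Matrix.trace_sub,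
    Matrix.trace_smul, hA, hB, smul_eq_mul]
  ring

lemma sq_mul_sum_sq_le_of_bound {d : ℕ} {M : Matrix (Fin d) (Fin d) ℝ} {σ : ℝ} (hσ : 0 < σ)
    (hM : ∀ v : EuclideanSpace ℝ (Fin d), σ * ‖v‖ ≤
      ‖(EuclideanSpace.equiv (Fin d) ℝ).symm (M.mulVec (EuclideanSpace.equiv (Fin d) ℝ v))‖)
    (v : Fin d → ℝ) : σ ^ 2 * ∑ i, v i ^ 2 ≤ ∑ i, (M.mulVec v) i ^ 2 := by
  have h := pow_le_pow_left₀ (by positivity) (hM ((EuclideanSpace.equiv (Fin d) ℝ).symm v)) 2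
  rw [mul_pow, EuclideanSpace.norm_sq_eq, EuclideanSpace.norm_sq_eq] at h
  simp only [Real.norm_eq_abs, sq_abs] at h
  exact h

lemma sq_mul_frobNorm_sq_le {d : ℕ} {M : Matrix (Fin d) (Fin d) ℝ} {σ : ℝ}
    (h : ∀ v : Fin d → ℝ, σ ^ 2 * ∑ i, v i ^ 2 ≤ ∑ i, (M.mulVec v) i ^ 2)
    (K : Matrix (Fin d) (Fin d) ℝ) : σ ^ 2 * frobNorm K ^ 2 ≤ frobNorm (M * K) ^ 2 := by
  rw [frobNorm_sq, frobNorm_sq, Finset.sum_comm, Finset.mul_sum]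
  rw [Finset.sum_comm (f := fun i j => (M * K) i j ^ 2)]
  exact Finset.sum_le_sum fun j _ => h fun i => K i j

/-- the three-dimensional matrix inequality. If every singular value of `M` is
at least `σ > 0` (i.e. `‖M v‖ ≥ σ ‖v‖` for every `v ∈ ℝ³` in the Euclidean norm), then
`(sgn(det A)·cof A − sgn(det M)·cof M) : (A − M)
  ≥ −(1 + (3/2)(1 + √3))·(|det M| / σ²)·|A − M|²`. -/
theorem stmt_1 (M A : Matrix (Fin 3) (Fin 3) ℝ) (σ : ℝ) (hσ : 0 < σ)
    (hM : ∀ v : EuclideanSpace ℝ (Fin 3), σ * ‖v‖ ≤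
      ‖(EuclideanSpace.equiv (Fin 3) ℝ).symm (M.mulVec (EuclideanSpace.equiv (Fin 3) ℝ v))‖) :
    frobInner (Real.sign A.det • cof A - Real.sign M.det • cof M) (A - M)
      ≥ -((1 + (3 / 2) * (1 + Real.sqrt 3)) * (|M.det| / σ ^ 2)) * (frobNorm (A - M)) ^ 2 := by
  have hb := sq_mul_sum_sq_le_of_bound hσ hM
  have hdet : M.det ≠ 0 := by
    intro h0
    obtain ⟨v, hv, hMv⟩ := Matrix.exists_mulVec_eq_zero_iff.mpr h0
    have h := hb v
    simp only [hMv, Pi.zero_apply, ne_eq, OfNat.ofNat_ne_zero, not_false_eq_true, zero_pow,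
      Finset.sum_const_zero] at h
    have hsum : ∑ i, v i ^ 2 = 0 :=
      le_antisymm (nonpos_of_mul_nonpos_right h (by positivity)) (by positivity)
    rw [Finset.sum_eq_zero_iff_of_nonneg fun i _ => sq_nonneg _] at hsum
    exact hv (funext fun i => by simpa using hsum i (Finset.mem_univ i))
  obtain ⟨K, hK⟩ : ∃ K, A - M = M * K :=
    ⟨M⁻¹ * (A - M), (Matrix.mul_nonsing_inv_cancel_left M _ hdet.isUnit).symm⟩
  have hA : A = M * (1 + K) := by rw [Matrix.mul_add, ← hK, Matrix.mul_one]; abel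
  have hKn := sq_mul_frobNorm_sq_le hb K
  have hmain := sign_det_mul_trace_adjugate_ge K
  rw [hK, hA, frobInner_sign_cof_sub]
  have hc : 5 ≤ 1 + 3 / 2 * (1 + Real.sqrt 3) := by
    have : 5 / 3 ≤ Real.sqrt 3 := Real.le_sqrt_of_sq_le (by norm_num)
    linarith
  have hdiv : frobNorm K ^ 2 ≤ frobNorm (M * K) ^ 2 / σ ^ 2 := by
    rw [le_div_iff₀ (by positivity)]
    linarith
  calc |M.det| * (Real.sign (1 + K).det * ((1 + K).adjugate * K).trace - K.trace)
      ≥ |M.det| * -((1 + 3 / 2 * (1 + Real.sqrt 3)) * (frobNorm (M * K) ^ 2 / σ ^ 2)) := by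
        refine mul_le_mul_of_nonneg_left ?_ (abs_nonneg _)
        have := mul_le_mul hc hdiv (by positivity) (by positivity)
        linarith
    _ = _ := by ring
end
end

section
/- Let c := 1 + (3/2)(1 + √3). For all nonnegative real numbers x, y, z one has (c − 1)·((x−1)² + (y−1)² + (z−1)²) + 3xyz − 3(x + y + z) + 6 ≥ 0. (This says the function g(B) = (c−1)|B−I|² + 3|det B| − 3 tr(B) + 6 is nonnegative on diagonal 3×3 matrices B = diag(x,y,z) with nonnegative entries.) -/
lemma sum_sq_add_products_nonneg_of_mul_nonneg {a b c : ℝ} (ha : -1 ≤ a) (hbc : 0 ≤ b * c) :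
    0 ≤ a ^ 2 + b ^ 2 + c ^ 2 + (a * b + b * c + c * a) + a * b * c := by
  have h : 0 ≤ (1 + a) * (b * c) := mul_nonneg (by linarith) hbc
  linarith [sq_nonneg (a + (b + c) / 2), sq_nonneg (b - c), sq_nonneg b, sq_nonneg c]

lemma sum_sq_add_products_nonneg {a b c : ℝ} (ha : -1 ≤ a) (hb : -1 ≤ b) (hc : -1 ≤ c) :
    0 ≤ a ^ 2 + b ^ 2 + c ^ 2 + (a * b + b * c + c * a) + a * b * c := by
  have h : 0 ≤ b * c ∨ 0 ≤ c * a ∨ 0 ≤ a * b := by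
    by_contra! h
    nlinarith [mul_pos_of_neg_of_neg h.1 h.2.1, sq_nonneg c]
  rcases h with h | h | h
  · exact sum_sq_add_products_nonneg_of_mul_nonneg ha h
  · linarith [sum_sq_add_products_nonneg_of_mul_nonneg hb h]
  · linarith [sum_sq_add_products_nonneg_of_mul_nonneg hc h]


/-- with `c := 1 + (3/2)(1 + √3)`, for all nonnegative reals `x, y, z`,
`(c − 1)·((x−1)² + (y−1)² + (z−1)²) + 3xyz − 3(x + y + z) + 6 ≥ 0`.
(Nonnegativity of `g(B) = (c−1)|B−I|² + 3|det B| − 3 tr B + 6` on diagonal 3×3 matrices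
with nonnegative entries.) -/
theorem stmt_5 (x y z : ℝ) (hx : 0 ≤ x) (hy : 0 ≤ y) (hz : 0 ≤ z) :
    (1 + (3 / 2) * (1 + Real.sqrt 3) - 1) * ((x - 1) ^ 2 + (y - 1) ^ 2 + (z - 1) ^ 2)
      + 3 * (x * y * z) - 3 * (x + y + z) + 6 ≥ 0 := by
  have h := sum_sq_add_products_nonneg (a := x - 1) (b := y - 1) (c := z - 1)
    (by linarith) (by linarith) (by linarith)
  have hs : 1 ≤ Real.sqrt 3 := Real.one_le_sqrt.mpr (by norm_num)
  have hm : 0 ≤ (Real.sqrt 3 - 1) * ((x - 1) ^ 2 + (y - 1) ^ 2 + (z - 1) ^ 2) :=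
    mul_nonneg (by linarith) (by positivity)
  linarith
end

section
/- Let 𝒳 and 𝒴 be real Banach spaces and let Φ : 𝒳 → 𝒴 be everywhere Fréchet differentiable, with dΦ(x; v) denoting the derivative of Φ at x applied to v. Let ℳ ⊆ 𝒳, let x₀ ∈ ℳ, λ > 0, and let x_λ ∈ ℳ satisfy: ‖Φ(x_λ)‖ ≤ ‖Φ(x₀)‖, and for every x ∈ ℳ with x ≠ x_λ, ‖Φ(x_λ)‖ < ‖Φ(x)‖ + (‖Φ(x₀)‖/λ)·‖x − x_λ‖ (these are the properties of the point produced by Ekeland's variational principle applied to F(x) = ‖Φ(x)‖ on ℳ). Suppose Φ(x_λ) ≠ 0, and suppose γ : [0,1] → 𝒳 satisfies γ(t) ∈ ℳ for all t, γ(0) = x_λ, and γ is right-differentiable at 0 with γ'(0) = ‖Φ(x_λ)‖·v for some v ∈ 𝒳, i.e. ‖γ(t) − x_λ − t·‖Φ(x_λ)‖·v‖/t → 0 as t → 0⁺. Then −1 + ‖Φ(x_λ)/‖Φ(x_λ)‖ + dΦ(x_λ; v)‖ ≥ −(‖Φ(x₀)‖/λ)·‖v‖. -/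
open Filter Topology Set in
/-- First-order necessary condition at a point where `‖Φ ·‖ + c * ‖· - γ 0‖` is minimal along
a right-differentiable curve. -/
theorem norm_le_norm_add_fderiv_of_le_along_curve {X Y : Type*}
    [NormedAddCommGroup X] [NormedSpace ℝ X] [NormedAddCommGroup Y] [NormedSpace ℝ Y]
    {Φ : X → Y} {γ : ℝ → X} {Φ' : X →L[ℝ] Y} {w : X} {c : ℝ}
    (hΦ : HasFDerivAt Φ Φ' (γ 0)) (hγ : HasDerivWithinAt γ w (Ioi 0) 0)
    (hmin : ∀ t ∈ Ioc (0 : ℝ) 1, ‖Φ (γ 0)‖ ≤ ‖Φ (γ t)‖ + c * ‖γ t - γ 0‖) :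
    ‖Φ (γ 0)‖ ≤ ‖Φ (γ 0) + Φ' w‖ + c * ‖w‖ := by
  have hΦγ : HasDerivWithinAt (Φ ∘ γ) (Φ' w) (Ioi 0) 0 := hΦ.comp_hasDerivWithinAt 0 hγ
  rw [hasDerivWithinAt_iff_tendsto_slope' (by simp)] at hγ hΦγ
  refine ge_of_tendsto ((hΦγ.const_add (Φ (γ 0))).norm.add (hγ.norm.const_mul c)) ?_
  filter_upwards [Ioc_mem_nhdsGT (zero_lt_one' ℝ)] with t ht
  have ht0 : 0 < t := ht.1
  have hγt : ‖γ t - γ 0‖ = t * ‖slope γ 0 t‖ := by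
    rw [← norm_smul_of_nonneg ht0.le]
    simpa using congrArg norm (sub_smul_slope γ 0 t).symm
  have hΦt : Φ (γ t) = (1 - t) • Φ (γ 0) + t • (Φ (γ 0) + slope (Φ ∘ γ) 0 t) := by
    have h : t • slope (Φ ∘ γ) 0 t = Φ (γ t) - Φ (γ 0) := by
      simpa using sub_smul_slope (Φ ∘ γ) 0 t
    rw [smul_add, h]
    module
  have hconv : ‖Φ (γ t)‖ ≤ (1 - t) * ‖Φ (γ 0)‖ + t * ‖Φ (γ 0) + slope (Φ ∘ γ) 0 t‖ := by
    rw [← norm_smul_of_nonneg (sub_nonneg.2 ht.2), ← norm_smul_of_nonneg ht0.le]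
    exact hΦt ▸ norm_add_le _ _
  have h := hmin t ht
  rw [hγt] at h
  refine le_of_mul_le_mul_left ?_ ht0
  linarith

/-- the Ekeland-variational-principle slope bound.  If `x_λ` satisfies the
conclusion of EVP for `F = ‖Φ(·)‖` on `ℳ`, `Φ(x_λ) ≠ 0`, and `γ` is a curve in `ℳ`
starting at `x_λ` with right derivative `‖Φ(x_λ)‖·v` at `0`, then
`−1 + ‖Φ(x_λ)/‖Φ(x_λ)‖ + dΦ(x_λ; v)‖ ≥ −(‖Φ(x₀)‖/λ)·‖v‖`. -/
theorem stmt_11 {X Y : Type*}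
    [NormedAddCommGroup X] [NormedSpace ℝ X] [CompleteSpace X]
    [NormedAddCommGroup Y] [NormedSpace ℝ Y] [CompleteSpace Y]
    (Φ : X → Y) (dΦ : X → X →L[ℝ] Y) (hΦ : ∀ x, HasFDerivAt Φ (dΦ x) x)
    (M : Set X) (x₀ : X) (hx₀ : x₀ ∈ M)
    (lam : ℝ) (hlam : 0 < lam)
    (xl : X) (hxl : xl ∈ M)
    (hF : ‖Φ xl‖ ≤ ‖Φ x₀‖)
    (hEVP : ∀ x ∈ M, x ≠ xl → ‖Φ xl‖ < ‖Φ x‖ + (‖Φ x₀‖ / lam) * ‖x - xl‖)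
    (hne : Φ xl ≠ 0)
    (γ : ℝ → X) (v : X)
    (hγM : ∀ t ∈ Set.Icc (0 : ℝ) 1, γ t ∈ M)
    (hγ0 : γ 0 = xl)
    (hγ' : Filter.Tendsto (fun t : ℝ => ‖γ t - xl - t • (‖Φ xl‖ • v)‖ / t)
      (nhdsWithin 0 (Set.Ioi 0)) (nhds 0)) :
    -1 + ‖(‖Φ xl‖)⁻¹ • Φ xl + dΦ xl v‖ ≥ -(‖Φ x₀‖ / lam) * ‖v‖ := by
  have ha : 0 < ‖Φ xl‖ := norm_pos_iff.2 hne
  have hc : 0 ≤ ‖Φ x₀‖ / lam := by positivity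
  subst hγ0
  have hγ : HasDerivWithinAt γ (‖Φ (γ 0)‖ • v) (Set.Ioi 0) 0 := by
    rw [hasDerivWithinAt_iff_tendsto]
    refine hγ'.congr' ?_
    filter_upwards [self_mem_nhdsWithin] with t ht
    rw [sub_zero, Real.norm_of_nonneg (le_of_lt ht), div_eq_inv_mul]
  have hmin : ∀ t ∈ Set.Ioc (0 : ℝ) 1,
      ‖Φ (γ 0)‖ ≤ ‖Φ (γ t)‖ + ‖Φ x₀‖ / lam * ‖γ t - γ 0‖ := by
    intro t ht
    by_cases h : γ t = γ 0
    · simp [h]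
    · exact (hEVP _ (hγM t ⟨ht.1.le, ht.2⟩) h).le
  have key := norm_le_norm_add_fderiv_of_le_along_curve (hΦ (γ 0)) hγ hmin
  have hscale : Φ (γ 0) + dΦ (γ 0) (‖Φ (γ 0)‖ • v) =
      ‖Φ (γ 0)‖ • (‖Φ (γ 0)‖⁻¹ • Φ (γ 0) + dΦ (γ 0) v) := by
    rw [map_smul, smul_add, smul_inv_smul₀ ha.ne']
  rw [hscale, norm_smul_of_nonneg ha.le, norm_smul_of_nonneg ha.le] at key
  have : 1 ≤ ‖‖Φ (γ 0)‖⁻¹ • Φ (γ 0) + dΦ (γ 0) v‖ + ‖Φ x₀‖ / lam * ‖v‖ := by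
    refine le_of_mul_le_mul_left ?_ ha
    linarith
  linarith
end

section
/- Let g : ℝ → ℝ be nondecreasing on [0, ∞), and let (a_k)_{k≥0}, (b_k)_{k≥0}, (c_k)_{k≥0} be sequences of nonnegative reals and (β_{k,n})_{k,n≥0} a doubly-indexed family of nonnegative reals such that for all n ≥ 0: a_{n+1} ≤ c_{n+1}·a₀ + ∑_{k=0}^{n} β_{k,n}·g(a_k) and b_{n+1} = b₀ + ∑_{k=0}^{n} β_{k,n}·g(b_k). If c̄ is a real number with c_k ≤ c̄ for all k, and max(c̄, 1)·a₀ ≤ b₀, then a_n ≤ b_n for all n ≥ 0. -/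
/-- discrete nonlinear Gronwall comparison lemma. -/
theorem stmt_12 (g : ℝ → ℝ) (hg : MonotoneOn g (Set.Ici (0 : ℝ)))
    (a b c : ℕ → ℝ) (β : ℕ → ℕ → ℝ)
    (ha : ∀ k, 0 ≤ a k) (hb : ∀ k, 0 ≤ b k) (hc : ∀ k, 0 ≤ c k)
    (hβ : ∀ k n, 0 ≤ β k n)
    (hreca : ∀ n, a (n + 1) ≤ c (n + 1) * a 0 + ∑ k ∈ Finset.range (n + 1), β k n * g (a k))
    (hrecb : ∀ n, b (n + 1) = b 0 + ∑ k ∈ Finset.range (n + 1), β k n * g (b k))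
    (cbar : ℝ) (hcbar : ∀ k, c k ≤ cbar)
    (h0 : max cbar 1 * a 0 ≤ b 0) :
    ∀ n, a n ≤ b n := by
  intro n
  induction n using Nat.strong_induction_on with
  | _ n ih =>
    cases n with
    | zero => exact (le_mul_of_one_le_left (ha 0) (le_max_right cbar 1)).trans h0
    | succ n =>
      have hc0 : c (n + 1) * a 0 ≤ b 0 :=
        (mul_le_mul_of_nonneg_right ((hcbar (n + 1)).trans (le_max_left cbar 1)) (ha 0)).trans h0
      have hsum : ∑ k ∈ Finset.range (n + 1), β k n * g (a k) ≤
          ∑ k ∈ Finset.range (n + 1), β k n * g (b k) :=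
        Finset.sum_le_sum fun k hk => mul_le_mul_of_nonneg_left
          (hg (ha k) (hb k) (ih k (Finset.mem_range.mp hk))) (hβ k n)
      rw [hrecb n]
      exact (hreca n).trans (add_le_add hc0 hsum)
end

section
/- Let Ω ⊂ ℝ^d be a bounded open set equipped with Lebesgue measure, let r > 2, and let Z : Ω → Ω be a measure-preserving map (the pushforward of Lebesgue measure restricted to Ω under Z equals itself). Let f : Ω → ℝ and g : Ω → [0, ∞) be measurable functions such that |f(x) − f(y)| ≤ (g(x) + g(y))·|x − y| for all x, y ∈ Ω. Then ‖f ∘ Z − f‖_{L^{r/(r−1)}(Ω)} ≤ 2·‖Z − id‖_{L^{r}(Ω)}·‖g‖_{L^{r/(r−2)}(Ω)}, where id denotes the identity map on Ω and |Z(x) − x| is measured in the Euclidean norm. -/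
noncomputable section

open MeasureTheory

/-- if `Z : Ω → Ω` preserves Lebesgue measure on the bounded open set `Ω`,
`r > 2`, and `|f(x) − f(y)| ≤ (g(x) + g(y))·|x − y|` on `Ω` with `g ≥ 0`, then
`‖f∘Z − f‖_{L^{r/(r−1)}(Ω)} ≤ 2·‖Z − id‖_{L^r(Ω)}·‖g‖_{L^{r/(r−2)}(Ω)}`. -/
theorem stmt_13 (d : ℕ) (Ω : Set (EuclideanSpace ℝ (Fin d))) (hΩo : IsOpen Ω)
    (hΩb : Bornology.IsBounded Ω)
    (r : ℝ) (hr : 2 < r)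
    (Z : EuclideanSpace ℝ (Fin d) → EuclideanSpace ℝ (Fin d))
    (hZmaps : Set.MapsTo Z Ω Ω)
    (hZmp : MeasurePreserving Z (volume.restrict Ω) (volume.restrict Ω))
    (f g : EuclideanSpace ℝ (Fin d) → ℝ)
    (hf : Measurable f) (hg : Measurable g) (hg0 : ∀ x ∈ Ω, 0 ≤ g x)
    (hlip : ∀ x ∈ Ω, ∀ y ∈ Ω, |f x - f y| ≤ (g x + g y) * ‖x - y‖) :
    eLpNorm (fun x => f (Z x) - f x) (ENNReal.ofReal (r / (r - 1))) (volume.restrict Ω)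
      ≤ 2 * eLpNorm (fun x => Z x - x) (ENNReal.ofReal r) (volume.restrict Ω)
          * eLpNorm g (ENNReal.ofReal (r / (r - 2))) (volume.restrict Ω) := by
  set μ := (volume : Measure (EuclideanSpace ℝ (Fin d))).restrict Ω
  have hr0 : 0 < r := by linarith
  have hr1 : 0 < r - 1 := by linarith
  have hr2 : 0 < r - 2 := by linarith
  have hconj : ENNReal.HolderTriple (ENNReal.ofReal r) (ENNReal.ofReal (r / (r - 2)))
      (ENNReal.ofReal (r / (r - 1))) := by
    refine ⟨?_⟩
    rw [← ENNReal.ofReal_inv_of_pos hr0, ← ENNReal.ofReal_inv_of_pos (div_pos hr0 hr2),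
      ← ENNReal.ofReal_inv_of_pos (div_pos hr0 hr1),
      ← ENNReal.ofReal_add (inv_nonneg.2 hr0.le) (inv_nonneg.2 (div_pos hr0 hr2).le)]
    congr 1
    field_simp
    ring
  have hq : 1 ≤ ENNReal.ofReal (r / (r - 2)) := by
    rw [ENNReal.one_le_ofReal, one_le_div hr2]
    linarith
  have hgμ : AEStronglyMeasurable g μ := hg.aestronglyMeasurable
  have hgZ : AEStronglyMeasurable (g ∘ Z) μ :=
    (hg.comp hZmp.measurable).aestronglyMeasurable
  have hdisp : AEStronglyMeasurable (fun x => Z x - x) μ :=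
    (hZmp.measurable.sub measurable_id).aestronglyMeasurable
  have hpt : ∀ᵐ x ∂μ, ‖f (Z x) - f x‖ ≤ ‖((g ∘ Z + g) • fun x => Z x - x) x‖ := by
    filter_upwards [ae_restrict_mem hΩo.measurableSet] with x hx
    have hsum : 0 ≤ g (Z x) + g x := add_nonneg (hg0 _ (hZmaps hx)) (hg0 x hx)
    simpa [norm_smul, abs_of_nonneg hsum] using hlip (Z x) (hZmaps hx) x hx
  calc
    eLpNorm (fun x => f (Z x) - f x) (ENNReal.ofReal (r / (r - 1))) μ
        ≤ eLpNorm ((g ∘ Z + g) • fun x => Z x - x) (ENNReal.ofReal (r / (r - 1))) μ :=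
      eLpNorm_mono_ae hpt
    _ ≤ eLpNorm (g ∘ Z + g) (ENNReal.ofReal (r / (r - 2))) μ
          * eLpNorm (fun x => Z x - x) (ENNReal.ofReal r) μ :=
      have := hconj.symm
      eLpNorm_smul_le_mul_eLpNorm hdisp (hgZ.add hgμ)
    _ ≤ (eLpNorm g (ENNReal.ofReal (r / (r - 2))) μ
          + eLpNorm g (ENNReal.ofReal (r / (r - 2))) μ)
          * eLpNorm (fun x => Z x - x) (ENNReal.ofReal r) μ := by
      gcongr
      calc
        _ ≤ eLpNorm (g ∘ Z) (ENNReal.ofReal (r / (r - 2))) μ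
            + eLpNorm g (ENNReal.ofReal (r / (r - 2))) μ := eLpNorm_add_le hgZ hgμ hq
        _ = _ := by rw [eLpNorm_comp_measurePreserving hgμ hZmp]
    _ = _ := by ring
end
end

section
/- Let Ω ⊂ ℝ^d be a bounded open set, r ∈ [1, ∞), let Z : Ω → Ω be a twice differentiable measure-preserving map (the pushforward of Lebesgue measure restricted to Ω under Z equals itself), and let f : ℝ^d → ℝ be twice continuously differentiable with bounded gradient. Then ‖Δ(f ∘ Z) − (Δf) ∘ Z‖_{L^r(Ω)} ≤ ‖∇f‖_{L^∞(Ω)}·‖ΔZ‖_{L^r(Ω)} + ‖D²f‖_{L^r(Ω)}·‖DZ·DZᵀ − I‖_{L^∞(Ω)}, where ΔZ := (ΔZ₁, …, ΔZ_d) is the componentwise Laplacian of Z (a vector field, measured in the Euclidean norm), DZ is the Jacobian matrix of Z, D²f is the Hessian of f (measured in the Frobenius norm), and I is the identity matrix. The proof rests on the pointwise identity Δ(f ∘ Z) − (Δf) ∘ Z = D²f(Z) : (DZ·DZᵀ − I) + ∇f(Z)·ΔZ and on ‖(D²f) ∘ Z‖_{L^r(Ω)} = ‖D²f‖_{L^r(Ω)}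 by measure preservation. -/
noncomputable section

open Matrix MeasureTheory

/-- Jacobian matrix `DZ` of a map `Z : ℝ^d → ℝ^d`, `(DZ)_{ij} = ∂_j Z_i`. -/
def jac {d : ℕ} (Z : EuclideanSpace ℝ (Fin d) → EuclideanSpace ℝ (Fin d))
    (x : EuclideanSpace ℝ (Fin d)) : Matrix (Fin d) (Fin d) ℝ :=
  Matrix.of fun i j => fderiv ℝ Z x (EuclideanSpace.single j 1) i

/-- Gradient `∇f` of a scalar function, as a vector of `ℝ^d`. -/
def grad {d : ℕ} (f : EuclideanSpace ℝ (Fin d) → ℝ) (x : EuclideanSpace ℝ (Fin d)) :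
    EuclideanSpace ℝ (Fin d) :=
  (EuclideanSpace.equiv (Fin d) ℝ).symm fun i => fderiv ℝ f x (EuclideanSpace.single i 1)

/-- Hessian matrix `D²f` of a scalar function: `(D²f)_{ij} = ∂_i ∂_j f`. -/
def hess {d : ℕ} (f : EuclideanSpace ℝ (Fin d) → ℝ) (x : EuclideanSpace ℝ (Fin d)) :
    Matrix (Fin d) (Fin d) ℝ :=
  Matrix.of fun i j =>
    fderiv ℝ (fun y => fderiv ℝ f y (EuclideanSpace.single j 1)) x (EuclideanSpace.single i 1)

/-- Laplacian `Δf = ∑ i ∂²_{ii} f` of a scalar function. -/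
def lap {d : ℕ} (f : EuclideanSpace ℝ (Fin d) → ℝ) (x : EuclideanSpace ℝ (Fin d)) : ℝ :=
  ∑ i, hess f x i i

/-- Componentwise Laplacian `ΔZ = (ΔZ₁, …, ΔZ_d)` of a vector field. -/
def vecLap {d : ℕ} (Z : EuclideanSpace ℝ (Fin d) → EuclideanSpace ℝ (Fin d))
    (x : EuclideanSpace ℝ (Fin d)) : EuclideanSpace ℝ (Fin d) :=
  (EuclideanSpace.equiv (Fin d) ℝ).symm fun i => lap (fun y => Z y i) x

/-- The Frobenius inner product is bounded by the product of the Frobenius norms. -/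
theorem abs_frobInner_le {d : ℕ} (A B : Matrix (Fin d) (Fin d) ℝ) :
    |∑ i, ∑ j, A i j * B i j| ≤ frobNorm A * frobNorm B := by
  unfold frobNorm
  simp only [← Fintype.sum_prod_type']
  rw [← Real.sqrt_mul (Finset.sum_nonneg fun _ _ => sq_nonneg _)]
  exact Real.abs_le_sqrt (Finset.sum_mul_sq_le_sq_mul_sq _ _ _)

theorem measurable_frobNorm {d : ℕ} {X : Type*} [MeasurableSpace X]
    {A : X → Matrix (Fin d) (Fin d) ℝ} (hA : ∀ i j, Measurable fun x => A x i j) :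
    Measurable fun x => frobNorm (A x) := by
  unfold frobNorm
  fun_prop

theorem measurable_hess {d : ℕ} (f : EuclideanSpace ℝ (Fin d) → ℝ) (i j : Fin d) :
    Measurable fun x => hess f x i j :=
  measurable_fderiv_apply_const ℝ _ _

theorem measurable_grad {d : ℕ} (f : EuclideanSpace ℝ (Fin d) → ℝ) : Measurable (grad f) :=
  (EuclideanSpace.equiv (Fin d) ℝ).symm.continuous.measurable.comp
    (measurable_pi_lambda _ fun _ => measurable_fderiv_apply_const ℝ _ _)

theorem measurable_vecLap {d : ℕ} (Z : EuclideanSpace ℝ (Fin d) → EuclideanSpace ℝ (Fin d)) :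
    Measurable (vecLap Z) :=
  (EuclideanSpace.equiv (Fin d) ℝ).symm.continuous.measurable.comp
    (measurable_pi_lambda _ fun _ => Finset.measurable_sum _ fun _ _ => measurable_hess _ _ _)

theorem measurable_jac {d : ℕ} (Z : EuclideanSpace ℝ (Fin d) → EuclideanSpace ℝ (Fin d))
    (i j : Fin d) : Measurable fun x => jac Z x i j := by
  have h : Measurable fun x => fderiv ℝ Z x (EuclideanSpace.single j 1) :=
    measurable_fderiv_apply_const ℝ _ _
  exact (EuclideanSpace.proj (𝕜 := ℝ) i).continuous.measurable.comp h

theorem hess_apply {d : ℕ} {f : EuclideanSpace ℝ (Fin d) → ℝ} {x : EuclideanSpace ℝ (Fin d)}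
    (hf : DifferentiableAt ℝ (fderiv ℝ f) x) (i j : Fin d) :
    hess f x i j =
      fderiv ℝ (fderiv ℝ f) x (EuclideanSpace.single i 1) (EuclideanSpace.single j 1) := by
  simp only [hess, Matrix.of_apply]
  rw [(hf.hasFDerivAt.clm_apply (hasFDerivAt_const _ _)).fderiv]
  simp

theorem EuclideanSpace.map_eq_sum_single {d : ℕ} {F : Type*} [AddCommGroup F] [Module ℝ F]
    [TopologicalSpace F] (L : EuclideanSpace ℝ (Fin d) →L[ℝ] F) (v : EuclideanSpace ℝ (Fin d)) :
    L v = ∑ i, v i • L (EuclideanSpace.single i 1) := by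
  have hv : v = ∑ i, v i • EuclideanSpace.single i (1 : ℝ) := by
    ext k
    simp [Finset.sum_apply, Pi.single_apply]
  conv_lhs => rw [hv]
  simp

section

variable {d : ℕ} {Z : EuclideanSpace ℝ (Fin d) → EuclideanSpace ℝ (Fin d)}
  {x : EuclideanSpace ℝ (Fin d)}

theorem vecLap_apply (hZ1 : ∀ᶠ y in nhds x, DifferentiableAt ℝ Z y)
    (hZ2 : DifferentiableAt ℝ (fderiv ℝ Z) x) (k : Fin d) :
    vecLap Z x k = ∑ i, fderiv ℝ (fderiv ℝ Z) x
      (EuclideanSpace.single i 1) (EuclideanSpace.single i 1) k := by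
  change lap (fun y => Z y k) x = _
  refine Finset.sum_congr rfl fun i _ => ?_
  have hev : (fun y => fderiv ℝ (fun y => Z y k) y (EuclideanSpace.single i 1)) =ᶠ[nhds x]
      fun y => EuclideanSpace.proj (𝕜 := ℝ) k (fderiv ℝ Z y (EuclideanSpace.single i 1)) := by
    filter_upwards [hZ1] with y hy
    have h := (EuclideanSpace.proj k : EuclideanSpace ℝ (Fin d) →L[ℝ] ℝ).hasFDerivAt.comp y
      hy.hasFDerivAt
    exact congrArg (fun L => L (EuclideanSpace.single i 1)) h.fderiv
  simp only [hess, Matrix.of_apply]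
  rw [hev.fderiv_eq]
  have h := (EuclideanSpace.proj k : EuclideanSpace ℝ (Fin d) →L[ℝ] ℝ).hasFDerivAt.comp x
    (hZ2.hasFDerivAt.clm_apply (hasFDerivAt_const (EuclideanSpace.single i (1 : ℝ)) x))
  refine (congrArg (fun L => L (EuclideanSpace.single i 1)) h.fderiv).trans ?_
  simp

theorem lap_comp {f : EuclideanSpace ℝ (Fin d) → ℝ} (hf : ContDiff ℝ 2 f)
    (hZ1 : ∀ᶠ y in nhds x, DifferentiableAt ℝ Z y)
    (hZ2 : DifferentiableAt ℝ (fderiv ℝ Z) x) :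
    lap (fun y => f (Z y)) x = ∑ i,
      (fderiv ℝ (fderiv ℝ f) (Z x) (fderiv ℝ Z x (EuclideanSpace.single i 1))
          (fderiv ℝ Z x (EuclideanSpace.single i 1))
        + fderiv ℝ f (Z x) (fderiv ℝ (fderiv ℝ Z) x
            (EuclideanSpace.single i 1) (EuclideanSpace.single i 1))) := by
  have hf1 : Differentiable ℝ f := hf.differentiable (by norm_num)
  have hf2 : Differentiable ℝ (fderiv ℝ f) :=
    (hf.fderiv_right (m := 1) (by norm_num)).differentiable (by norm_num)
  refine Finset.sum_congr rfl fun i _ => ?_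
  have hev : (fun y => fderiv ℝ (fun y => f (Z y)) y (EuclideanSpace.single i 1)) =ᶠ[nhds x]
      fun y => fderiv ℝ f (Z y) (fderiv ℝ Z y (EuclideanSpace.single i 1)) := by
    filter_upwards [hZ1] with y hy
    have h := (hf1 (Z y)).hasFDerivAt.comp y hy.hasFDerivAt
    exact congrArg (fun L => L (EuclideanSpace.single i 1)) h.fderiv
  simp only [hess, Matrix.of_apply]
  rw [hev.fderiv_eq]
  have h := ((hf2 (Z x)).hasFDerivAt.comp x hZ1.self_of_nhds.hasFDerivAt).clm_apply
    (hZ2.hasFDerivAt.clm_apply (hasFDerivAt_const (EuclideanSpace.single i (1 : ℝ)) x))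
  refine (congrArg (fun L => L (EuclideanSpace.single i 1)) h.fderiv).trans ?_
  simp [add_comm]

/-- `Δ(f ∘ Z) − (Δf) ∘ Z = ∇f(Z) · ΔZ + D²f(Z) : (DZ DZᵀ − I)`. -/
theorem lap_comp_sub {f : EuclideanSpace ℝ (Fin d) → ℝ} (hf : ContDiff ℝ 2 f)
    (hZ1 : ∀ᶠ y in nhds x, DifferentiableAt ℝ Z y)
    (hZ2 : DifferentiableAt ℝ (fderiv ℝ Z) x) :
    lap (fun y => f (Z y)) x - lap f (Z x) =
      inner ℝ (grad f (Z x)) (vecLap Z x)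
        + ∑ i, ∑ j, hess f (Z x) i j * (jac Z x * (jac Z x)ᵀ - 1) i j := by
  have hf2 : Differentiable ℝ (fderiv ℝ f) :=
    (hf.fderiv_right (m := 1) (by norm_num)).differentiable (by norm_num)
  have hquad (v : EuclideanSpace ℝ (Fin d)) :
      fderiv ℝ (fderiv ℝ f) (Z x) v v = ∑ j, ∑ k, v j * v k * hess f (Z x) j k := by
    rw [EuclideanSpace.map_eq_sum_single (fderiv ℝ (fderiv ℝ f) (Z x)) v, _root_.sum_apply]
    refine Finset.sum_congr rfl fun j _ => ?_
    rw [_root_.smul_apply, EuclideanSpace.map_eq_sum_single _ v, Finset.smul_sum]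
    refine Finset.sum_congr rfl fun k _ => ?_
    rw [hess_apply (hf2 _), smul_eq_mul, smul_eq_mul, mul_assoc]
  have hgrad : ∑ i, fderiv ℝ f (Z x) (fderiv ℝ (fderiv ℝ Z) x
      (EuclideanSpace.single i 1) (EuclideanSpace.single i 1)) =
      inner ℝ (grad f (Z x)) (vecLap Z x) := by
    rw [PiLp.inner_apply]
    simp only [vecLap_apply hZ1 hZ2]
    rw [Finset.sum_congr rfl fun i _ => EuclideanSpace.map_eq_sum_single _ _, Finset.sum_comm]
    refine Finset.sum_congr rfl fun k _ => ?_
    simp [grad, Finset.sum_mul]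
  have hhess : ∑ i, fderiv ℝ (fderiv ℝ f) (Z x) (fderiv ℝ Z x (EuclideanSpace.single i 1))
      (fderiv ℝ Z x (EuclideanSpace.single i 1)) =
      ∑ j, ∑ k, hess f (Z x) j k * (jac Z x * (jac Z x)ᵀ) j k := by
    simp only [hquad]
    rw [Finset.sum_comm]
    refine Finset.sum_congr rfl fun j _ => ?_
    rw [Finset.sum_comm]
    refine Finset.sum_congr rfl fun k _ => ?_
    simp only [Matrix.mul_apply, Matrix.transpose_apply, jac, Matrix.of_apply, Finset.mul_sum]
    exact Finset.sum_congr rfl fun i _ => by ring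
  have hlap : lap f (Z x) =
      ∑ j, ∑ k, hess f (Z x) j k * (1 : Matrix (Fin d) (Fin d) ℝ) j k := by
    simp [lap, Matrix.one_apply]
  rw [lap_comp hf hZ1 hZ2, Finset.sum_add_distrib, hgrad, hhess, hlap]
  simp only [Matrix.sub_apply, mul_sub, Finset.sum_sub_distrib]
  ring

end

/-- for a twice differentiable measure-preserving map `Z : Ω → Ω` and a C²
function `f` with bounded gradient,
`‖Δ(f∘Z) − (Δf)∘Z‖_{L^r(Ω)} ≤ ‖∇f‖_{L^∞(Ω)}·‖ΔZ‖_{L^r(Ω)}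
  + ‖D²f‖_{L^r(Ω)}·‖DZ·DZᵀ − I‖_{L^∞(Ω)}`. -/
theorem stmt_14 (d : ℕ) (Ω : Set (EuclideanSpace ℝ (Fin d))) (hΩo : IsOpen Ω)
    (hΩb : Bornology.IsBounded Ω)
    (r : ℝ) (hr : 1 ≤ r)
    (Z : EuclideanSpace ℝ (Fin d) → EuclideanSpace ℝ (Fin d))
    (hZmaps : Set.MapsTo Z Ω Ω)
    (hZmp : MeasurePreserving Z (volume.restrict Ω) (volume.restrict Ω))
    (hZd1 : ∀ x ∈ Ω, DifferentiableAt ℝ Z x)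
    (hZd2 : ∀ x ∈ Ω, DifferentiableAt ℝ (fun y => fderiv ℝ Z y) x)
    (f : EuclideanSpace ℝ (Fin d) → ℝ) (hf : ContDiff ℝ 2 f)
    (hgrad : ∃ C, ∀ x, ‖grad f x‖ ≤ C) :
    eLpNorm (fun x => lap (fun y => f (Z y)) x - lap f (Z x))
        (ENNReal.ofReal r) (volume.restrict Ω)
      ≤ eLpNorm (grad f) ⊤ (volume.restrict Ω)
            * eLpNorm (fun x => vecLap Z x) (ENNReal.ofReal r) (volume.restrict Ω)
        + eLpNorm (fun x => frobNorm (hess f x)) (ENNReal.ofReal r) (volume.restrict Ω)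
            * eLpNorm (fun x => frobNorm (jac Z x * (jac Z x)ᵀ - 1)) ⊤ (volume.restrict Ω) := by
  set μ := volume.restrict Ω
  have hZm : Measurable Z := hZmp.measurable
  have hid : ∀ᵐ x ∂μ, lap (fun y => f (Z y)) x - lap f (Z x) =
      inner ℝ (grad f (Z x)) (vecLap Z x)
        + ∑ i, ∑ j, hess f (Z x) i j * (jac Z x * (jac Z x)ᵀ - 1) i j := by
    filter_upwards [ae_restrict_mem hΩo.measurableSet] with x hx
    exact lap_comp_sub hf (Filter.mem_of_superset (hΩo.mem_nhds hx) hZd1) (hZd2 x hx)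
  have hmJ (i j : Fin d) : Measurable fun x => (jac Z x * (jac Z x)ᵀ - 1) i j := by
    simp only [Matrix.sub_apply, Matrix.mul_apply, Matrix.transpose_apply]
    exact (Finset.measurable_sum _ fun k _ =>
      (measurable_jac Z i k).mul (measurable_jac Z j k)).sub_const _
  have hmG : Measurable fun x => grad f (Z x) := (measurable_grad f).comp hZm
  have hmF : Measurable fun x => frobNorm (hess f x) := measurable_frobNorm (measurable_hess f)
  have hm1 : Measurable fun x => inner ℝ (grad f (Z x)) (vecLap Z x) :=
    hmG.inner (measurable_vecLap Z)
  have hm2 : Measurable fun x =>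
      ∑ i, ∑ j, hess f (Z x) i j * (jac Z x * (jac Z x)ᵀ - 1) i j :=
    Finset.measurable_sum _ fun i _ => Finset.measurable_sum _ fun j _ =>
      ((measurable_hess f i j).comp hZm).mul (hmJ i j)
  rw [eLpNorm_congr_ae hid]
  refine (eLpNorm_add_le hm1.aestronglyMeasurable hm2.aestronglyMeasurable
    (by simpa using hr)).trans (add_le_add ?_ ?_)
  · rw [← eLpNorm_comp_measurePreserving (measurable_grad f).aestronglyMeasurable hZmp]
    simpa using eLpNorm_le_eLpNorm_top_mul_eLpNorm (ENNReal.ofReal r) (grad f ∘ Z)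
      (measurable_vecLap Z).aestronglyMeasurable (fun u v => inner ℝ u v) 1
      (.of_forall fun x => by simpa using nnnorm_inner_le_nnnorm (𝕜 := ℝ) _ _)
  · rw [← eLpNorm_comp_measurePreserving hmF.aestronglyMeasurable hZmp]
    have hprod := eLpNorm_le_eLpNorm_mul_eLpNorm_top (ENNReal.ofReal r)
      (μ := μ) (hmF.comp hZm).aestronglyMeasurable
      (fun x => frobNorm (jac Z x * (jac Z x)ᵀ - 1)) (fun u v => u * v) 1
      (.of_forall fun x => by simp)
    rw [ENNReal.coe_one, one_mul] at hprod
    refine le_trans (eLpNorm_mono fun x => ?_) hprod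
    exact (abs_frobInner_le _ _).trans (le_abs_self _)
end
end

section
/- Let α ∈ (0, 1), let h₀, τ, μ, C₁ > 0, and set M := 2h₀. Define a sequence (h_n)_{n≥0} by h(0) = h₀ and h(n+1) = h₀ + τ·C₁·∑_{k=0}^{n} (μτ(n+1−k))^{−α}·(h(k)² + μ^{−α}τ^{1−α}·h(k)³). Let N ≥ 1 be an integer such that (C₁/(1−α))·μ^{−α}·(τN)^{1−α}·(M² + μ^{−α}τ^{1−α}·M³) ≤ M/2. Then h(n) ≤ M for all 0 ≤ n ≤ N. -/
/-- Comparison of `∑ j^{-α}` with `∫ x^{-α}`. -/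
theorem sum_range_add_one_rpow_neg_le {α : ℝ} (hα0 : 0 ≤ α) (hα1 : α < 1) (m : ℕ) :
    ∑ j ∈ Finset.range m, ((j : ℝ) + 1) ^ (-α) ≤ (m : ℝ) ^ (1 - α) / (1 - α) := by
  have hα : 0 < 1 - α := by linarith
  induction m with
  | zero => simp [Real.zero_rpow hα.ne']
  | succ m ih =>
    have hm : (0 : ℝ) < (m : ℝ) + 1 := by positivity
    have bernoulli : (1 + -(1 / ((m : ℝ) + 1))) ^ (1 - α)
        ≤ 1 + (1 - α) * -(1 / ((m : ℝ) + 1)) := by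
      refine rpow_one_add_le_one_add_mul_self ?_ hα.le (by linarith)
      rw [neg_le_neg_iff, div_le_one hm]
      linarith [(Nat.cast_nonneg m : (0 : ℝ) ≤ m)]
    have base : 1 + -(1 / ((m : ℝ) + 1)) = m / ((m : ℝ) + 1) := by field_simp; ring
    rw [base, Real.div_rpow (Nat.cast_nonneg m) hm.le,
      div_le_iff₀ (Real.rpow_pos_of_pos hm _)] at bernoulli
    have split : ((m : ℝ) + 1) ^ (1 - α) = ((m : ℝ) + 1) ^ (-α) * ((m : ℝ) + 1) := by
      rw [sub_eq_neg_add, Real.rpow_add_one hm.ne']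
    have step : (m : ℝ) ^ (1 - α)
        ≤ ((m : ℝ) + 1) ^ (1 - α) - (1 - α) * ((m : ℝ) + 1) ^ (-α) := by
      refine bernoulli.trans_eq ?_
      rw [split]
      field_simp
      ring
    rw [Finset.sum_range_succ, Nat.cast_succ]
    rw [le_div_iff₀ hα] at ih ⊢
    linarith

/-- Bound on the discrete Duhamel kernel with singularity of order `α`. -/
theorem mul_sum_range_rpow_neg_le {α τ μ : ℝ} (hα0 : 0 ≤ α) (hα1 : α < 1)
    (hτ : 0 < τ) (hμ : 0 < μ) (n : ℕ) :
    τ * ∑ k ∈ Finset.range (n + 1), (μ * τ * ((n : ℝ) + 1 - (k : ℝ))) ^ (-α)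
      ≤ μ ^ (-α) * (τ * ((n : ℝ) + 1)) ^ (1 - α) / (1 - α) := by
  have reflect : ∑ k ∈ Finset.range (n + 1), (μ * τ * ((n : ℝ) + 1 - (k : ℝ))) ^ (-α)
      = μ ^ (-α) * τ ^ (-α) * ∑ j ∈ Finset.range (n + 1), ((j : ℝ) + 1) ^ (-α) := by
    rw [← Finset.sum_flip (fun j : ℕ => ((j : ℝ) + 1) ^ (-α)), Finset.mul_sum]
    refine Finset.sum_congr rfl fun k hk => ?_
    have hkn : k ≤ n := Nat.lt_succ_iff.mp (Finset.mem_range.mp hk)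
    have hkn' : (k : ℝ) ≤ n := by exact_mod_cast hkn
    rw [Nat.cast_sub hkn, ← Real.mul_rpow hμ.le hτ.le,
      ← Real.mul_rpow (by positivity) (by linarith)]
    ring_nf
  have split : τ ^ (1 - α) = τ ^ (-α) * τ := by
    rw [sub_eq_neg_add, Real.rpow_add_one hτ.ne']
  have hsum := sum_range_add_one_rpow_neg_le hα0 hα1 (n + 1)
  rw [Nat.cast_succ] at hsum
  rw [reflect, Real.mul_rpow hτ.le (by positivity)]
  calc τ * (μ ^ (-α) * τ ^ (-α) * ∑ j ∈ Finset.range (n + 1), ((j : ℝ) + 1) ^ (-α))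
      = μ ^ (-α) * τ ^ (1 - α) * ∑ j ∈ Finset.range (n + 1), ((j : ℝ) + 1) ^ (-α) := by
        rw [split]; ring
    _ ≤ μ ^ (-α) * τ ^ (1 - α) * (((n : ℝ) + 1) ^ (1 - α) / (1 - α)) := by gcongr
    _ = μ ^ (-α) * (τ ^ (1 - α) * ((n : ℝ) + 1) ^ (1 - α)) / (1 - α) := by ring

/-- the discrete comparison bound behind the uniform `L^r` control of the
velocity iterates.  With `M = 2h₀`, if
`(C₁/(1−α))·μ^{−α}·(τN)^{1−α}·(M² + μ^{−α}τ^{1−α}M³) ≤ M/2`, then the sequence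
`h(n+1) = h₀ + τC₁ ∑_{k=0}^{n} (μτ(n+1−k))^{−α}(h(k)² + μ^{−α}τ^{1−α}h(k)³)`
stays below `M` for all `0 ≤ n ≤ N`. -/
theorem stmt_15 (α h₀ τ μ C₁ M : ℝ)
    (hα0 : 0 < α) (hα1 : α < 1)
    (hh₀ : 0 < h₀) (hτ : 0 < τ) (hμ : 0 < μ) (hC₁ : 0 < C₁)
    (hM : M = 2 * h₀)
    (h : ℕ → ℝ) (h0 : h 0 = h₀)
    (hrec : ∀ n : ℕ, h (n + 1) = h₀ + τ * C₁ * ∑ k ∈ Finset.range (n + 1),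
      (μ * τ * ((n : ℝ) + 1 - (k : ℝ))) ^ (-α)
        * ((h k) ^ 2 + μ ^ (-α) * τ ^ (1 - α) * (h k) ^ 3))
    (N : ℕ) (hN : 1 ≤ N)
    (hNbound : (C₁ / (1 - α)) * μ ^ (-α) * (τ * (N : ℝ)) ^ (1 - α)
        * (M ^ 2 + μ ^ (-α) * τ ^ (1 - α) * M ^ 3) ≤ M / 2) :
    ∀ n ≤ N, h n ≤ M := by
  have hα : 0 < 1 - α := by linarith
  have hM0 : 0 < M := by linarith
  set c := μ ^ (-α) * τ ^ (1 - α)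
  have hc0 : 0 < c := by positivity
  have kernel_nonneg : ∀ n, ∀ k ∈ Finset.range (n + 1),
      0 ≤ (μ * τ * ((n : ℝ) + 1 - (k : ℝ))) ^ (-α) := by
    intro n k hk
    have hkn : (k : ℝ) < n + 1 := by exact_mod_cast Finset.mem_range.mp hk
    exact Real.rpow_nonneg (mul_nonneg (by positivity) (by linarith)) _
  have h_nonneg : ∀ n, 0 ≤ h n := by
    intro n
    induction n using Nat.strong_induction_on with
    | _ n ih =>
      rcases n with _ | n
      · rw [h0]; exact hh₀.le
      · rw [hrec]
        refine add_nonneg hh₀.le (mul_nonneg (by positivity) (Finset.sum_nonneg fun k hk => ?_))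
        have hk0 := ih k (Finset.mem_range.mp hk)
        exact mul_nonneg (kernel_nonneg n k hk) (by positivity)
  intro n
  induction n using Nat.strong_induction_on with
  | _ n ih =>
    intro hn
    rcases n with _ | n
    · rw [h0]; linarith
    · have hnN : (n : ℝ) + 1 ≤ N := by exact_mod_cast hn
      calc h (n + 1)
          = h₀ + τ * C₁ * ∑ k ∈ Finset.range (n + 1),
              (μ * τ * ((n : ℝ) + 1 - (k : ℝ))) ^ (-α) * ((h k) ^ 2 + c * (h k) ^ 3) := hrec n
        _ ≤ h₀ + τ * C₁ * ∑ k ∈ Finset.range (n + 1),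
              (μ * τ * ((n : ℝ) + 1 - (k : ℝ))) ^ (-α) * (M ^ 2 + c * M ^ 3) := by
            gcongr with k hk
            · exact kernel_nonneg n k hk
            · exact h_nonneg k
            · exact ih k (Finset.mem_range.mp hk) ((Finset.mem_range.mp hk).le.trans hn)
            · exact h_nonneg k
            · exact ih k (Finset.mem_range.mp hk) ((Finset.mem_range.mp hk).le.trans hn)
        _ = h₀ + C₁ * (τ * ∑ k ∈ Finset.range (n + 1),
              (μ * τ * ((n : ℝ) + 1 - (k : ℝ))) ^ (-α)) * (M ^ 2 + c * M ^ 3) := by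
            rw [← Finset.sum_mul]; ring
        _ ≤ h₀ + C₁ * (μ ^ (-α) * (τ * ((n : ℝ) + 1)) ^ (1 - α) / (1 - α))
              * (M ^ 2 + c * M ^ 3) := by
            gcongr
            exact mul_sum_range_rpow_neg_le hα0.le hα1 hτ hμ n
        _ ≤ h₀ + C₁ * (μ ^ (-α) * (τ * (N : ℝ)) ^ (1 - α) / (1 - α))
              * (M ^ 2 + c * M ^ 3) := by
            gcongr
        _ = h₀ + C₁ / (1 - α) * μ ^ (-α) * (τ * (N : ℝ)) ^ (1 - α)
              * (M ^ 2 + c * M ^ 3) := by ring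
        _ ≤ M := by linarith
end
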